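/- arXiv:2201.09461 — 4 statements merged into one kernel-verified Lean document; each statement's English description precedes it below -/
import Mathlib

section
/- Let V : ℝ → ℝ be a differentiable function with V(t) ≥ 0 for all t, and let α, β, p, q, k > 0 be constants with p·k < 1 and q·k > 1. Suppose that for all t ≥ 0 the derivative satisfies V'(t) ≤ -(α·V(t)^p + β·V(t)^q)^k. Then V(t) = 0 for all t ≥ T_s, where T_s = 1/(α^k·(1 - p·k)) + 1/(β^k·(q·k - 1)). -/
/-- Integrated form of the differential inequality `V' ≤ -c V^a` for a positive function. -/
lemma rpow_div_sub_le_of_deriv_le_neg_mul_rpow {V : ℝ → ℝ} (hV : Differentiable ℝ V)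
    {a c u v : ℝ} (ha : a ≠ 1) (huv : u ≤ v) (hpos : ∀ s ∈ Set.Icc u v, 0 < V s)
    (hderiv : ∀ s ∈ Set.Icc u v, deriv V s ≤ -(c * V s ^ a)) :
    V v ^ (1 - a) / (1 - a) - V u ^ (1 - a) / (1 - a) ≤ -c * (v - u) := by
  have hr : 1 - a ≠ 0 := sub_ne_zero.mpr ha.symm
  have hd : ∀ s ∈ Set.Icc u v,
      HasDerivAt (fun s => V s ^ (1 - a) / (1 - a)) (deriv V s * V s ^ (-a)) s := by
    intro s hs
    have h := ((hV s).hasDerivAt.rpow_const (p := 1 - a)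
      (Or.inl (hpos s hs).ne')).div_const (1 - a)
    rwa [sub_sub_cancel_left, mul_right_comm, mul_div_cancel_right₀ _ hr] at h
  refine (convex_Icc u v).image_sub_le_mul_sub_of_deriv_le
    (f := fun s => V s ^ (1 - a) / (1 - a))
    (fun s hs => (hd s hs).continuousAt.continuousWithinAt)
    (fun s hs => (hd s (interior_subset hs)).differentiableAt.differentiableWithinAt)
    (fun s hs => ?_) u (Set.left_mem_Icc.mpr huv) v (Set.right_mem_Icc.mpr huv) huv
  have hs' := interior_subset hs
  rw [(hd s hs').deriv]
  have hVs := hpos s hs'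
  calc deriv V s * V s ^ (-a) ≤ -(c * V s ^ a) * V s ^ (-a) :=
        mul_le_mul_of_nonneg_right (hderiv s hs') (Real.rpow_nonneg hVs.le _)
    _ = -c * (V s ^ a * V s ^ (-a)) := by ring
    _ = -c := by rw [← Real.rpow_add hVs, add_neg_cancel, Real.rpow_zero, mul_one]

/-- Fixed-time stability lemma (Lemma 1, Polyakov): a nonnegative differentiable
function satisfying `V' ≤ -(α V^p + β V^q)^k` vanishes after the settling time
`T_s = 1/(α^k (1 - p k)) + 1/(β^k (q k - 1))`. -/
theorem fixed_time_stability
    (V : ℝ → ℝ) (hV : Differentiable ℝ V) (hVnonneg : ∀ t : ℝ, 0 ≤ V t)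
    (α β p q k : ℝ) (hα : 0 < α) (hβ : 0 < β) (hp : 0 < p) (hq : 0 < q)
    (hk : 0 < k) (hpk : p * k < 1) (hqk : 1 < q * k)
    (hderiv : ∀ t : ℝ, 0 ≤ t →
      deriv V t ≤ -(α * V t ^ p + β * V t ^ q) ^ k) :
    ∀ t : ℝ, 1 / (α ^ k * (1 - p * k)) + 1 / (β ^ k * (q * k - 1)) ≤ t →
      V t = 0 := by
  intro t ht
  have hαk : 0 < α ^ k := Real.rpow_pos_of_pos hα k
  have hβk : 0 < β ^ k := Real.rpow_pos_of_pos hβ k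
  have hpk' : 0 < 1 - p * k := sub_pos.mpr hpk
  have hqk' : 0 < q * k - 1 := sub_pos.mpr hqk
  set T₁ := 1 / (α ^ k * (1 - p * k)) with hT₁
  set T₂ := 1 / (β ^ k * (q * k - 1)) with hT₂
  have hT₁pos : 0 < T₁ := by positivity
  have hT₂pos : 0 < T₂ := by positivity
  have hVp : ∀ s, 0 ≤ V s ^ p := fun s => Real.rpow_nonneg (hVnonneg s) p
  have hVq : ∀ s, 0 ≤ V s ^ q := fun s => Real.rpow_nonneg (hVnonneg s) q
  have hdp : ∀ s, 0 ≤ s → deriv V s ≤ -(α ^ k * V s ^ (p * k)) := by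
    intro s hs
    refine (hderiv s hs).trans (neg_le_neg ?_)
    rw [Real.rpow_mul (hVnonneg s), ← Real.mul_rpow hα.le (hVp s)]
    exact Real.rpow_le_rpow (mul_nonneg hα.le (hVp s))
      (le_add_of_nonneg_right (mul_nonneg hβ.le (hVq s))) hk.le
  have hdq : ∀ s, 0 ≤ s → deriv V s ≤ -(β ^ k * V s ^ (q * k)) := by
    intro s hs
    refine (hderiv s hs).trans (neg_le_neg ?_)
    rw [Real.rpow_mul (hVnonneg s), ← Real.mul_rpow hβ.le (hVq s)]
    exact Real.rpow_le_rpow (mul_nonneg hβ.le (hVq s))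
      (le_add_of_nonneg_left (mul_nonneg hα.le (hVp s))) hk.le
  have hanti : AntitoneOn V (Set.Ici 0) := by
    refine antitoneOn_of_deriv_nonpos (convex_Ici 0) hV.continuous.continuousOn
      hV.differentiableOn fun s hs => (hdp s (interior_subset hs)).trans ?_
    exact neg_nonpos.mpr (mul_nonneg hαk.le (Real.rpow_nonneg (hVnonneg s) _))
  by_contra hne
  have hVt : 0 < V t := lt_of_le_of_ne (hVnonneg t) (Ne.symm hne)
  have ht0 : 0 ≤ t := by linarith
  have hpos : ∀ s, 0 ≤ s → s ≤ t → 0 < V s := fun s hs hst =>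
    hVt.trans_le (hanti hs ht0 hst)
  have hV₂pos : 0 < V T₂ := hpos T₂ hT₂pos.le (by linarith)
  have hV₂ : V T₂ < 1 := by
    have h := rpow_div_sub_le_of_deriv_le_neg_mul_rpow hV hqk.ne' hT₂pos.le
      (fun s hs => hpos s hs.1 (by linarith [hs.2])) (fun s hs => hdq s hs.1)
    have h0 : 0 < V 0 ^ (1 - q * k) := Real.rpow_pos_of_pos (hpos 0 le_rfl ht0) _
    rw [← sub_div, div_le_iff_of_neg (by linarith)] at h
    have he : -β ^ k * (T₂ - 0) * (1 - q * k) = 1 := by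
      rw [hT₂]
      field_simp
      ring
    rw [he] at h
    by_contra! hge
    linarith [Real.rpow_le_one_of_one_le_of_nonpos hge (by linarith : 1 - q * k ≤ 0)]
  have h := rpow_div_sub_le_of_deriv_le_neg_mul_rpow hV hpk.ne
    (by linarith : T₂ ≤ t) (fun s hs => hpos s (hT₂pos.le.trans hs.1) hs.2)
    (fun s hs => hdp s (hT₂pos.le.trans hs.1))
  rw [← sub_div, div_le_iff₀ hpk'] at h
  have he : α ^ k * (1 - p * k) * T₁ = 1 := by
    rw [hT₁]
    field_simp
  have hle : α ^ k * (1 - p * k) * T₁ ≤ α ^ k * (1 - p * k) * (t - T₂) :=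
    mul_le_mul_of_nonneg_left (by linarith) (by positivity)
  linarith [Real.rpow_lt_one hV₂pos.le hV₂ hpk', Real.rpow_pos_of_pos hVt (1 - p * k)]
end

section
/- Let N be a positive natural number, B : Fin N → Fin N → ℝ a symmetric matrix with all entries nonnegative, B₀ : Fin N → ℝ with B₀ i ≥ 0 for all i, and let σ > 0 and δ > 0 be real constants. Let ρ = min_i (B₀ i) and let b₁ : ℝ satisfy b₁·‖x‖² ≤ ∑_i ∑_j x i · B i j · x j for every x : Fin N → ℝ (i.e., b₁ is a lower bound for the quadratic form of B, such as its smallest eigenvalue). Define the symmetric matrix S by S i i = (1 + B₀ i)·σ + 2·B i i·δ and S i j = B i j·δ for i ≠ j. Then every eigenvalue τ of S (equivalently, every value of the eigenvalue function of the Hermitian matrix S) satisfies τ ≥ (1 + ρ)·σ + b₁·δ. -/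
/-- A real matrix whose quadratic form dominates `c‖x‖²` has its real spectrum in `[c, ∞)`. -/
theorem Matrix.le_of_mem_spectrum_of_le_dotProduct_mulVec {n : Type*} [Fintype n] [DecidableEq n]
    {A : Matrix n n ℝ} {c : ℝ} (h : ∀ x : n → ℝ, c * (x ⬝ᵥ x) ≤ x ⬝ᵥ (A.mulVec x))
    {τ : ℝ} (hτ : τ ∈ spectrum ℝ A) : c ≤ τ := by
  rw [← Matrix.spectrum_toLin', ← Module.End.hasEigenvalue_iff_mem_spectrum] at hτ
  obtain ⟨x, hx⟩ := hτ.exists_hasEigenvector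
  have hAx : A.mulVec x = τ • x := by simpa using hx.apply_eq_smul
  have hpos : 0 < x ⬝ᵥ x :=
    lt_of_le_of_ne (Finset.sum_nonneg fun i _ => mul_self_nonneg (x i))
      fun h0 => hx.2 (dotProduct_self_eq_zero.mp h0.symm)
  have hx' := h x
  rw [hAx, dotProduct_smul, smul_eq_mul] at hx'
  exact le_of_mul_le_mul_right hx' hpos

/-- Lower bound in result (R5) of Lemma 3 for `δ > 0`: every eigenvalue `τ` of
the comparison matrix `S` satisfies `τ ≥ (1 + ρ)σ + b₁ δ`, where
`ρ = minᵢ B₀ i` and `b₁` is a lower bound for the quadratic form of `B`. -/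
theorem S_eigenvalue_lower_bound
    (N : ℕ) (hN : 0 < N) (B : Fin N → Fin N → ℝ)
    (hBsymm : ∀ i j, B i j = B j i) (hB : ∀ i j, 0 ≤ B i j)
    (B₀ : Fin N → ℝ) (hB₀ : ∀ i, 0 ≤ B₀ i)
    (σ δ : ℝ) (hσ : 0 < σ) (hδ : 0 < δ)
    (ρ : ℝ)
    (hρ : ρ = Finset.univ.inf'
      (Finset.univ_nonempty_iff.mpr (Fin.pos_iff_nonempty.mp hN)) B₀)
    (b₁ : ℝ)
    (hb₁ : ∀ x : Fin N → ℝ, b₁ * (∑ i, x i ^ 2) ≤ ∑ i, ∑ j, x i * B i j * x j)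
    (S : Matrix (Fin N) (Fin N) ℝ)
    (hS : ∀ i j, S i j =
      if i = j then (1 + B₀ i) * σ + 2 * B i i * δ else B i j * δ) :
    ∀ τ ∈ spectrum ℝ S, (1 + ρ) * σ + b₁ * δ ≤ τ := by
  intro τ hτ
  refine Matrix.le_of_mem_spectrum_of_le_dotProduct_mulVec (fun x => ?_) hτ
  have hrow (i : Fin N) : x i * S.mulVec x i =
      ((1 + B₀ i) * σ + B i i * δ) * x i ^ 2 + δ * ∑ j, x i * B i j * x j := by
    have hentry (j : Fin N) : S i j * x j =
        (if i = j then ((1 + B₀ i) * σ + B i i * δ) * x j else 0) + δ * (B i j * x j) := by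
      rw [hS]
      split_ifs with hij
      · subst hij; ring
      · ring
    simp only [Matrix.mulVec, dotProduct, hentry, Finset.sum_add_distrib, Finset.sum_ite_eq,
      Finset.mem_univ, if_true, ← Finset.mul_sum, mul_assoc]
    ring
  have hdiag : (1 + ρ) * σ * ∑ i, x i ^ 2 ≤
      ∑ i, ((1 + B₀ i) * σ + B i i * δ) * x i ^ 2 := by
    rw [Finset.mul_sum]
    refine Finset.sum_le_sum fun i _ => mul_le_mul_of_nonneg_right ?_ (sq_nonneg _)
    have hρi : ρ ≤ B₀ i := hρ ▸ Finset.inf'_le _ (Finset.mem_univ i)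
    have hσi := mul_le_mul_of_nonneg_right hρi hσ.le
    have hBi := mul_nonneg (hB i i) hδ.le
    linarith
  have hquad := mul_le_mul_of_nonneg_left (hb₁ x) hδ.le
  simp only [dotProduct, hrow, Finset.sum_add_distrib, ← Finset.mul_sum, ← pow_two]
  linarith
end

section
/- Let N be a positive natural number, B : Fin N → Fin N → ℝ a symmetric matrix with all entries nonnegative, B₀ : Fin N → ℝ with B₀ i ≥ 0 for all i, and let σ > 0 and δ > 0 be real constants. Let ρ = min_i (B₀ i) and let b₁ : ℝ satisfy b₁·‖x‖² ≤ ∑_i ∑_j x i · B i j · x j for every x : Fin N → ℝ. Suppose (1 + ρ)·σ + b₁·δ > 0. Then the symmetric matrix S defined by S i i = (1 + B₀ i)·σ + 2·B i i·δ and S i j = B i j·δ for i ≠ j is positive definite. -/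
/-- Assumption (A2) for `δ > 0` implies `τ₁ > 0`: if `(1 + ρ)σ + b₁ δ > 0`, then
the comparison matrix `S` from Lemma 3 is positive definite. -/
theorem S_posDef
    (N : ℕ) (hN : 0 < N) (B : Fin N → Fin N → ℝ)
    (hBsymm : ∀ i j, B i j = B j i) (hB : ∀ i j, 0 ≤ B i j)
    (B₀ : Fin N → ℝ) (hB₀ : ∀ i, 0 ≤ B₀ i)
    (σ δ : ℝ) (hσ : 0 < σ) (hδ : 0 < δ)
    (ρ : ℝ)
    (hρ : ρ = Finset.univ.inf'
      (Finset.univ_nonempty_iff.mpr (Fin.pos_iff_nonempty.mp hN)) B₀)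
    (b₁ : ℝ)
    (hb₁ : ∀ x : Fin N → ℝ, b₁ * (∑ i, x i ^ 2) ≤ ∑ i, ∑ j, x i * B i j * x j)
    (hA2 : 0 < (1 + ρ) * σ + b₁ * δ)
    (S : Matrix (Fin N) (Fin N) ℝ)
    (hS : ∀ i j, S i j =
      if i = j then (1 + B₀ i) * σ + 2 * B i i * δ else B i j * δ) :
    S.PosDef := by
  refine Matrix.PosDef.of_dotProduct_mulVec_pos ?_ fun x hx => ?_
  · ext i j
    by_cases h : i = j
    · simp [h]
    · simp [hS, h, Ne.symm h, hBsymm i j]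
  have hρ_le (i : Fin N) : ρ ≤ B₀ i := hρ ▸ Finset.inf'_le _ (Finset.mem_univ i)
  have hform : star x ⬝ᵥ S.mulVec x =
      ∑ i, ((1 + B₀ i) * σ + B i i * δ) * x i ^ 2 + δ * ∑ i, ∑ j, x i * B i j * x j := by
    simp only [dotProduct, Matrix.mulVec, star_trivial]
    rw [Finset.mul_sum, ← Finset.sum_add_distrib]
    refine Finset.sum_congr rfl fun i _ => ?_
    have hrow (j : Fin N) : S i j * x j =
        (if i = j then ((1 + B₀ i) * σ + B i i * δ) * x i else 0) + B i j * δ * x j := by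
      rw [hS]
      split_ifs with h
      · subst h; ring
      · ring
    simp only [hrow, Finset.sum_add_distrib, Finset.sum_ite_eq, Finset.mem_univ, if_true,
      mul_add, Finset.mul_sum]
    congr 1
    · ring
    · exact Finset.sum_congr rfl fun j _ => by ring
  have hdiag : (1 + ρ) * σ * ∑ i, x i ^ 2 ≤ ∑ i, ((1 + B₀ i) * σ + B i i * δ) * x i ^ 2 := by
    rw [Finset.mul_sum]
    gcongr with i
    have h₁ := mul_le_mul_of_nonneg_right (hρ_le i) hσ.le
    have h₂ := mul_nonneg (hB i i) hδ.le
    linarith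
  have hnorm : 0 < ∑ i, x i ^ 2 := by
    obtain ⟨i, hi⟩ := Function.ne_iff.mp hx
    exact Finset.sum_pos' (fun j _ => sq_nonneg _) ⟨i, Finset.mem_univ i, sq_pos_of_ne_zero hi⟩
  rw [hform]
  have hquad := mul_le_mul_of_nonneg_left (hb₁ x) hδ.le
  have hpos := mul_pos hA2 hnorm
  linarith
end

section
/- Let V : ℝ → ℝ be a differentiable function with V(t) ≥ 0 for all t, let α, β > 0 be real constants, and let μ, ν be real numbers with 0 < μ < 1 and ν > 1. Suppose that for all t ≥ 0 the derivative satisfies V'(t) ≤ −α·V(t)^((3+μ)/4) − β·V(t)^((3+ν)/4). Then V(t) = 0 for all t ≥ T_s, where T_s = 4/(α·(1 − μ)) + 4/(β·(ν − 1)). -/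
/-- Integrated form of the differential inequality `V' ≤ -c V ^ (1 - r)` for positive `V`. -/
theorem rpow_div_sub_le_of_deriv_le {V : ℝ → ℝ} (hV : Differentiable ℝ V) {c r x y : ℝ}
    (hr : r ≠ 0) (hxy : x ≤ y) (hpos : ∀ s ∈ Set.Icc x y, 0 < V s)
    (hderiv : ∀ s ∈ Set.Icc x y, deriv V s ≤ -c * V s ^ (1 - r)) :
    V y ^ r / r - V x ^ r / r ≤ -c * (y - x) := by
  have hd : ∀ s ∈ Set.Icc x y,
      HasDerivAt (fun s => V s ^ r / r) (V s ^ (r - 1) * deriv V s) s := by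
    intro s hs
    have h := ((hV s).hasDerivAt.rpow_const (p := r) (Or.inl (hpos s hs).ne')).div_const r
    rwa [mul_right_comm, mul_div_cancel_right₀ _ hr, mul_comm] at h
  refine (convex_Icc x y).image_sub_le_mul_sub_of_deriv_le
    (fun s hs => (hd s hs).continuousAt.continuousWithinAt)
    (fun s hs => (hd s (interior_subset hs)).differentiableAt.differentiableWithinAt)
    (fun s hs => ?_) x (Set.left_mem_Icc.2 hxy) y (Set.right_mem_Icc.2 hxy) hxy
  have hs := interior_subset hs
  have hone : V s ^ (r - 1) * V s ^ (1 - r) = 1 := by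
    rw [← Real.rpow_add (hpos s hs)]
    simp
  rw [(hd s hs).deriv]
  calc V s ^ (r - 1) * deriv V s
      ≤ V s ^ (r - 1) * (-c * V s ^ (1 - r)) :=
        mul_le_mul_of_nonneg_left (hderiv s hs) (Real.rpow_nonneg (hpos s hs).le _)
    _ = -c * (V s ^ (r - 1) * V s ^ (1 - r)) := by ring
    _ = -c := by rw [hone, mul_one]

/-- The final differential inequality of Theorem 1 (equn 22): a nonnegative
differentiable `V` with `V' ≤ −α V^((3+μ)/4) − β V^((3+ν)/4)` vanishes after
the settling time `T_s = 4/(α(1−μ)) + 4/(β(ν−1))`. -/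
theorem settling_time_bound
    (V : ℝ → ℝ) (hV : Differentiable ℝ V) (hVnonneg : ∀ t : ℝ, 0 ≤ V t)
    (α β μ ν : ℝ) (hα : 0 < α) (hβ : 0 < β)
    (hμ0 : 0 < μ) (hμ1 : μ < 1) (hν : 1 < ν)
    (hderiv : ∀ t : ℝ, 0 ≤ t →
      deriv V t ≤ -α * V t ^ ((3 + μ) / 4) - β * V t ^ ((3 + ν) / 4)) :
    ∀ t : ℝ, 4 / (α * (1 - μ)) + 4 / (β * (ν - 1)) ≤ t → V t = 0 := by
  intro t ht
  by_contra hne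
  have hVt : 0 < V t := lt_of_le_of_ne (hVnonneg t) (Ne.symm hne)
  have hμ' : 0 < 1 - μ := sub_pos.2 hμ1
  have hν' : 0 < ν - 1 := sub_pos.2 hν
  have hα_term : ∀ s, 0 ≤ α * V s ^ ((3 + μ) / 4) := fun s =>
    mul_nonneg hα.le (Real.rpow_nonneg (hVnonneg s) _)
  have hβ_term : ∀ s, 0 ≤ β * V s ^ ((3 + ν) / 4) := fun s =>
    mul_nonneg hβ.le (Real.rpow_nonneg (hVnonneg s) _)
  set a := 4 / (α * (1 - μ)) with ha
  set b := 4 / (β * (ν - 1)) with hb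
  have ha0 : 0 < a := by positivity
  have hb0 : 0 < b := by positivity
  have hanti : AntitoneOn V (Set.Ici 0) := by
    refine antitoneOn_of_deriv_nonpos (convex_Ici 0) hV.continuous.continuousOn
      hV.differentiableOn fun s hs => ?_
    linarith [hderiv s (interior_subset hs), hα_term s, hβ_term s]
  have hpos : ∀ s, 0 ≤ s → s ≤ t → 0 < V s := fun s hs hst =>
    hVt.trans_le (hanti hs (hs.trans hst) hst)
  have hVb : V b < 1 := by
    have h := rpow_div_sub_le_of_deriv_le hV (c := β) (r := (1 - ν) / 4) (x := 0) (y := b)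
      (by linarith : (1 - ν) / 4 < 0).ne hb0.le
      (fun s hs => hpos s hs.1 (by linarith [hs.2]))
      (fun s hs => by
        rw [show 1 - (1 - ν) / 4 = (3 + ν) / 4 by ring]
        linarith [hderiv s hs.1, hα_term s])
    have hrate : β * b * ((ν - 1) / 4) = 1 := by
      rw [hb]
      field_simp
    rw [← sub_div, div_le_iff_of_neg (by linarith)] at h
    have h0 : 0 < V 0 ^ ((1 - ν) / 4) := Real.rpow_pos_of_pos (hpos 0 le_rfl (by linarith)) _
    by_contra! hge
    have h1 := Real.rpow_le_one_of_one_le_of_nonpos hge (by linarith : (1 - ν) / 4 ≤ 0)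
    nlinarith
  have h := rpow_div_sub_le_of_deriv_le hV (c := α) (r := (1 - μ) / 4) (x := b) (y := t)
    (by positivity) (by linarith)
    (fun s hs => hpos s (hb0.le.trans hs.1) hs.2)
    (fun s hs => by
      rw [show 1 - (1 - μ) / 4 = (3 + μ) / 4 by ring]
      linarith [hderiv s (hb0.le.trans hs.1), hβ_term s])
  have hrate : α * a * ((1 - μ) / 4) = 1 := by
    rw [ha]
    field_simp
  rw [← sub_div, div_le_iff₀ (by positivity)] at h
  have hb1 := Real.rpow_lt_one (hVnonneg b) hVb (by positivity : 0 < (1 - μ) / 4)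
  have ht0 := Real.rpow_pos_of_pos hVt ((1 - μ) / 4)
  have hmono : α * a * ((1 - μ) / 4) ≤ α * (t - b) * ((1 - μ) / 4) := by
    gcongr
    linarith
  linarith
end
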